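/- Let G ∈ F_2, let (G,w) be a 4-unbalanced pair, and assume G does not admit a star cutset. Let F = a-v_1-u_1 be a heavy seagull in G. Then there exist two cliques K_1, K_2 of G (each of size at most 2) such that the canonical two-clique-separation S(K_1,K_2) is active and A(K_1,K_2) ∩ {a, u_1} ≠ ∅. -/

import Mathlib

open SimpleGraph Set List

namespace Paper

variable {V : Type} {W : Type}

/-- The closed neighborhood `N[v]` of a vertex. -/
def closedNbhd (G : SimpleGraph V) (v : V) : Set V := insert v (G.neighborSet v)

/-- The degree of a vertex (as the number of its neighbors). -/
noncomputable def deg (G : SimpleGraph V) (v : V) : ℕ := (G.neighborSet v).ncard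

/-- `G` contains `H` as an induced subgraph, i.e. some induced subgraph of `G` is
isomorphic to `H`. -/
def ContainsInduced (G : SimpleGraph V) (H : SimpleGraph W) : Prop :=
  ∃ s : Set V, Nonempty (H ≃g G.induce s)

/-- `(A, C, B)` is a separation of `G`. -/
def IsSeparation (G : SimpleGraph V) (A C B : Set V) : Prop :=
  A ∪ C ∪ B = Set.univ ∧ Disjoint A C ∧ Disjoint A B ∧ Disjoint C B ∧
    ∀ a ∈ A, ∀ b ∈ B, ¬G.Adj a b

/-- `G` admits a star cutset. -/
def HasStarCutset (G : SimpleGraph V) : Prop :=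
  ∃ A C B : Set V, IsSeparation G A C B ∧ A.Nonempty ∧ B.Nonempty ∧
    ∃ v ∈ C, C ⊆ closedNbhd G v

/-- `G` admits a clique cutset. -/
def HasCliqueCutset (G : SimpleGraph V) : Prop :=
  ∃ A C B : Set V, IsSeparation G A C B ∧ A.Nonempty ∧ B.Nonempty ∧ G.IsClique C

/-- `D` is a connected component of `G \ X`: a maximal connected subset of `Xᶜ`. -/
def IsComponentOf (G : SimpleGraph V) (X : Set V) (D : Set V) : Prop :=
  D.Nonempty ∧ D ⊆ Xᶜ ∧ (G.induce D).Connected ∧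
    ∀ D' : Set V, D ⊆ D' → D' ⊆ Xᶜ → (G.induce D').Connected → D' = D

/-- An induced path in `G` ("path" in the paper always means induced path). -/
def IsIPath (G : SimpleGraph V) {u v : V} (P : G.Walk u v) : Prop :=
  P.IsPath ∧ P.toSubgraph.IsInduced

/-- A hole: an induced cycle of length at least four. -/
def IsHole (G : SimpleGraph V) {v : V} (c : G.Walk v v) : Prop :=
  c.IsCycle ∧ 4 ≤ c.length ∧ c.toSubgraph.IsInduced

/-- `G` is sparse: for every hole and every vertex not in it, there is an edge `ab` of the
hole containing all neighbors of the vertex in the hole. -/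
def Sparse (G : SimpleGraph V) : Prop :=
  ∀ (v : V) (c : G.Walk v v), IsHole G c → ∀ x, x ∉ c.support →
    ∃ a b, c.toSubgraph.Adj a b ∧ ∀ y ∈ c.support, G.Adj x y → y = a ∨ y = b

/-- `G` contains a pyramid (necessarily as an induced subgraph). -/
def ContainsPyramid (G : SimpleGraph V) : Prop :=
  ∃ (a b₁ b₂ b₃ : V) (P₁ : G.Walk a b₁) (P₂ : G.Walk a b₂) (P₃ : G.Walk a b₃),
    G.Adj b₁ b₂ ∧ G.Adj b₂ b₃ ∧ G.Adj b₁ b₃ ∧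
    IsIPath G P₁ ∧ IsIPath G P₂ ∧ IsIPath G P₃ ∧
    1 ≤ P₁.length ∧ 1 ≤ P₂.length ∧ 1 ≤ P₃.length ∧
    ¬(P₁.length = 1 ∧ P₂.length = 1) ∧ ¬(P₁.length = 1 ∧ P₃.length = 1) ∧
    ¬(P₂.length = 1 ∧ P₃.length = 1) ∧
    (∀ p ∈ P₁.support, p ≠ a → ∀ q ∈ P₂.support, q ≠ a →
      p ≠ q ∧ (G.Adj p q → p = b₁ ∧ q = b₂)) ∧
    (∀ p ∈ P₁.support, p ≠ a → ∀ q ∈ P₃.support, q ≠ a →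
      p ≠ q ∧ (G.Adj p q → p = b₁ ∧ q = b₃)) ∧
    (∀ p ∈ P₂.support, p ≠ a → ∀ q ∈ P₃.support, q ≠ a →
      p ≠ q ∧ (G.Adj p q → p = b₂ ∧ q = b₃))

/-- `G` contains a prism (necessarily as an induced subgraph). -/
def ContainsPrism (G : SimpleGraph V) : Prop :=
  ∃ (a₁ a₂ a₃ b₁ b₂ b₃ : V) (P₁ : G.Walk a₁ b₁) (P₂ : G.Walk a₂ b₂) (P₃ : G.Walk a₃ b₃),
    G.Adj a₁ a₂ ∧ G.Adj a₂ a₃ ∧ G.Adj a₁ a₃ ∧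
    G.Adj b₁ b₂ ∧ G.Adj b₂ b₃ ∧ G.Adj b₁ b₃ ∧
    IsIPath G P₁ ∧ IsIPath G P₂ ∧ IsIPath G P₃ ∧
    1 ≤ P₁.length ∧ 1 ≤ P₂.length ∧ 1 ≤ P₃.length ∧
    (∀ p ∈ P₁.support, ∀ q ∈ P₂.support,
      p ≠ q ∧ (G.Adj p q → (p = a₁ ∧ q = a₂) ∨ (p = b₁ ∧ q = b₂))) ∧
    (∀ p ∈ P₁.support, ∀ q ∈ P₃.support,
      p ≠ q ∧ (G.Adj p q → (p = a₁ ∧ q = a₃) ∨ (p = b₁ ∧ q = b₃))) ∧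
    (∀ p ∈ P₂.support, ∀ q ∈ P₃.support,
      p ≠ q ∧ (G.Adj p q → (p = a₂ ∧ q = a₃) ∨ (p = b₂ ∧ q = b₃)))

/-- `G` is very sparse: sparse, pyramid-free and prism-free. -/
def VerySparse (G : SimpleGraph V) : Prop :=
  Sparse G ∧ ¬ContainsPyramid G ∧ ¬ContainsPrism G

/-- `G ∈ 𝓕_t`: `G` is very sparse with no clique of size at least `t+1`. -/
def MemF (t : ℕ) (G : SimpleGraph V) : Prop :=
  VerySparse G ∧ ∀ s : Set V, G.IsClique s → s.ncard ≤ t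

/-- `G` has a tree decomposition of width at most `k`. -/
def HasTreewidthAtMost (G : SimpleGraph V) (k : ℕ) : Prop :=
  ∃ (ι : Type) (T : SimpleGraph ι) (χ : ι → Finset V),
    T.IsTree ∧
    (∀ v : V, ∃ t, v ∈ χ t) ∧
    (∀ u v : V, G.Adj u v → ∃ t, u ∈ χ t ∧ v ∈ χ t) ∧
    (∀ v : V, (T.induce {t | v ∈ χ t}).Connected) ∧
    ∀ t, (χ t).card ≤ k + 1

/-- The `n`-by-`n` wall, as a brick wall graph: `n` rows of `2n` vertices each,
with horizontal path edges in each row, and vertical edges between consecutive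
rows placed alternately. -/
def Wall (n : ℕ) : SimpleGraph (Fin n × Fin (2 * n)) :=
  SimpleGraph.fromRel (fun a b =>
    (a.1 = b.1 ∧ a.2.val + 1 = b.2.val) ∨
    (a.2 = b.2 ∧ a.1.val + 1 = b.1.val ∧ (a.1.val + a.2.val) % 2 = 0))

/-- The graph obtained from `G` by subdividing the edge `uv` once (the new vertex
is `none`). -/
def subdivideEdge (G : SimpleGraph V) (u v : V) : SimpleGraph (Option V) :=
  SimpleGraph.fromRel (fun a b =>
    (∃ x y : V, a = some x ∧ b = some y ∧ G.Adj x y ∧ ¬(x = u ∧ y = v) ∧ ¬(x = v ∧ y = u)) ∨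
    (a = none ∧ (b = some u ∨ b = some v)))

/-- `IsSubdivision G H`: `G` is (isomorphic to) a graph obtained from `H` by repeatedly
subdividing edges. -/
inductive IsSubdivision : {α : Type} → SimpleGraph α → {β : Type} → SimpleGraph β → Prop where
  | base {α β : Type} {G : SimpleGraph α} {H : SimpleGraph β} :
      Nonempty (G ≃g H) → IsSubdivision G H
  | step {α β : Type} {G : SimpleGraph α} {H : SimpleGraph β} (u v : β) :
      H.Adj u v → IsSubdivision G (subdivideEdge H u v) → IsSubdivision G H

/-- `G` contains a subdivision of the `t`-by-`t` wall as an induced subgraph. -/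
def ContainsWallSubdiv (G : SimpleGraph V) (t : ℕ) : Prop :=
  ∃ (α : Type) (S : SimpleGraph α), IsSubdivision S (Wall t) ∧ ContainsInduced G S

/-- `G` contains the line graph of a subdivision of the `t`-by-`t` wall as an induced
subgraph. -/
def ContainsLineWallSubdiv (G : SimpleGraph V) (t : ℕ) : Prop :=
  ∃ (α : Type) (S : SimpleGraph α), IsSubdivision S (Wall t) ∧
    ContainsInduced G S.lineGraph

/-- `G` is `𝓣₁`-free: no vertex has two or more neighbors in a hole not containing it. -/
def T1Free (G : SimpleGraph V) : Prop :=
  ∀ (v : V) (c : G.Walk v v), IsHole G c → ∀ x, x ∉ c.support →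
    ∀ y z, y ∈ c.support → z ∈ c.support → G.Adj x y → G.Adj x z → y = z

/-- `G` is `𝓣₂`-free: no vertex has two non-adjacent neighbors in a hole not containing
it, and `G` is pyramid-free and prism-free. -/
def T2Free (G : SimpleGraph V) : Prop :=
  (∀ (v : V) (c : G.Walk v v), IsHole G c → ∀ x, x ∉ c.support →
    ∀ y z, y ∈ c.support → z ∈ c.support → G.Adj x y → G.Adj x z → y ≠ z → G.Adj y z) ∧
  ¬ContainsPyramid G ∧ ¬ContainsPrism G

/-- The weight `w(X)` of a set of vertices. -/
noncomputable def setW (w : V → ℝ) (X : Set V) : ℝ := ∑ᶠ x ∈ X, w x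

/-- `w` is a weight function on `G`: values in `[0,1]` with total weight `1`. -/
def IsWeightFn (w : V → ℝ) : Prop :=
  (∀ v, 0 ≤ w v ∧ w v ≤ 1) ∧ setW w Set.univ = 1

/-- `X` is a `(w, c)`-balanced separator. -/
def IsBalSep (G : SimpleGraph V) (w : V → ℝ) (c : ℝ) (X : Set V) : Prop :=
  ∀ D, IsComponentOf G X D → setW w D ≤ c

/-- `(G, w)` is `d`-unbalanced: `w` is a weight function and there is no
`(w, 1/2)`-balanced separator of size at most `d`. -/
def Unbalanced (G : SimpleGraph V) (w : V → ℝ) (d : ℕ) : Prop :=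
  IsWeightFn w ∧ ∀ X : Set V, X.ncard ≤ d → ¬IsBalSep G w (1 / 2 : ℝ) X

/-- `B = B(K₁,K₂)` is the (unique) component of `G ∖ (K₁ ∪ K₂)` of weight more
than `1/2`.  Then `A(K₁,K₂) = (B ∪ K₁ ∪ K₂)ᶜ` and `S(K₁,K₂) = (A, K₁ ∪ K₂, B)` is the
canonical two-clique-separation for `{K₁, K₂}`. -/
def IsCanonicalB (G : SimpleGraph V) (w : V → ℝ) (K₁ K₂ B : Set V) : Prop :=
  IsComponentOf G (K₁ ∪ K₂) B ∧ (1 / 2 : ℝ) < setW w B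

/-- The open neighborhood `N(D)` of a set of vertices. -/
def nbhdOfSet (G : SimpleGraph V) (D : Set V) : Set V :=
  {v | v ∉ D ∧ ∃ d ∈ D, G.Adj v d}

/-- The canonical two-clique-separation `S(K₁,K₂)` (with big side `B`) is proper. -/
def ProperPair (G : SimpleGraph V) (w : V → ℝ) (K₁ K₂ B : Set V) : Prop :=
  IsCanonicalB G w K₁ K₂ B ∧
  (∃ D, IsComponentOf G (K₁ ∪ K₂) D ∧ D ⊆ (B ∪ K₁ ∪ K₂)ᶜ ∧
    K₁ ∪ K₂ ⊆ nbhdOfSet G D) ∧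
  (K₁.ncard = 1 → K₂.ncard = 1 →
    ¬∃ (x y : V) (P : G.Walk x y), K₁ = {x} ∧ K₂ = {y} ∧ IsIPath G P ∧
      {v | v ∈ P.support} = (B ∪ K₁ ∪ K₂)ᶜ ∪ K₁ ∪ K₂)

/-- The canonical two-clique-separation `S(K₁,K₂)` (with big side `B`) is active,
where `K` bounds the size of the cliques considered. -/
def ActivePair (G : SimpleGraph V) (w : V → ℝ) (K : ℕ) (K₁ K₂ B : Set V) : Prop :=
  ProperPair G w K₁ K₂ B ∧
  ∀ K₁' K₂' B' : Set V, G.IsClique K₁' → G.IsClique K₂' →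
    K₁'.ncard ≤ K → K₂'.ncard ≤ K → ProperPair G w K₁' K₂' B' →
    K₁ ∪ K₂ ≠ K₁' ∪ K₂' →
      ¬(B' ∪ K₁' ∪ K₂' ⊂ B ∪ K₁ ∪ K₂) ∧
      (B' ∪ K₁' ∪ K₂' = B ∪ K₁ ∪ K₂ → B' ⊂ B)

/-- The interiors of two paths from `a` to `b` are disjoint and anticomplete. -/
def IntDisjAnti (G : SimpleGraph V) {a b : V} (P Q : G.Walk a b) : Prop :=
  ∀ x ∈ P.support, x ≠ a → x ≠ b → ∀ y ∈ Q.support, y ≠ a → y ≠ b → x ≠ y ∧ ¬G.Adj x y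

/-- `Q₁, Q₂, Q₃` form a theta (as an induced subgraph of `G`) with ends `a, b`. -/
def ThetaCfg (G : SimpleGraph V) {a b : V} (Q₁ Q₂ Q₃ : G.Walk a b) : Prop :=
  ¬G.Adj a b ∧
  IsIPath G Q₁ ∧ IsIPath G Q₂ ∧ IsIPath G Q₃ ∧
  2 ≤ Q₁.length ∧ 2 ≤ Q₂.length ∧ 2 ≤ Q₃.length ∧
  IntDisjAnti G Q₁ Q₂ ∧ IntDisjAnti G Q₁ Q₃ ∧ IntDisjAnti G Q₂ Q₃

/-- There is a theta through the seagull `a-v-u` in `G`: a theta one of whose ends is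
`a` or `u` and which contains the seagull. -/
def ThetaThroughSeagull (G : SimpleGraph V) (a v u : V) : Prop :=
  (∃ (b : V) (Q₁ Q₂ Q₃ : G.Walk a b), ThetaCfg G Q₁ Q₂ Q₃ ∧ [a, v, u] <+: Q₁.support) ∨
  (∃ (b : V) (Q₁ Q₂ Q₃ : G.Walk u b), ThetaCfg G Q₁ Q₂ Q₃ ∧ [u, v, a] <+: Q₁.support)

/-- `a-v-u` is a heavy seagull in `G`: an induced three-vertex path whose ends both
have degree at least three. -/
def HeavySeagull (G : SimpleGraph V) (a v u : V) : Prop :=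
  a ≠ u ∧ G.Adj a v ∧ G.Adj v u ∧ ¬G.Adj a u ∧ 3 ≤ deg G a ∧ 3 ≤ deg G u

end Paper

namespace Paper

section
variable {V : Type}
/-- `P` is the vertex set of an induced path from `x` to `y`. -/
inductive PS (G : SimpleGraph V) : V → V → Set V → Prop
  | nil (x : V) : PS G x x {x}
  | cons {x y z : V} {P : Set V} : G.Adj x y → PS G y z P → x ∉ P →
      (∀ p ∈ P, G.Adj x p → p = y) → PS G x z (insert x P)

theorem PS.start_mem {G : SimpleGraph V} {x y : V} {P : Set V} (h : PS G x y P) : x ∈ P := by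
  cases h <;> simp

theorem PS.end_mem {G : SimpleGraph V} {x y : V} {P : Set V} (h : PS G x y P) : y ∈ P := by
  induction h with
  | nil x => simp
  | cons _ _ _ _ ih => exact Or.inr ih

theorem PS.sub {G : SimpleGraph V} {y z : V} {P : Set V} (h : PS G y z P) :
    ∀ x ∈ P, ∃ P' ⊆ P, PS G x z P' := by
  induction h with
  | nil x => intro s hs; rw [mem_singleton_iff] at hs; subst hs; exact ⟨_, subset_rfl, PS.nil _⟩
  | @cons x y z P hxy hP hx hn ih =>
    intro s hs
    rcases hs with rfl | hs
    · exact ⟨_, subset_rfl, PS.cons hxy hP hx hn⟩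
    · obtain ⟨P', h1, h2⟩ := ih s hs
      exact ⟨P', h1.trans (subset_insert _ _), h2⟩

theorem PS.prepend {G : SimpleGraph V} {y z : V} {P : Set V} (h : PS G y z P) :
    ∀ x, x ∉ P → (∃ p ∈ P, G.Adj x p) → ∃ P' ⊆ insert x P, PS G x z P' := by
  induction h with
  | nil y =>
    rintro x hx ⟨p, hp, hxp⟩
    rw [mem_singleton_iff] at hp; subst hp
    refine ⟨insert x {p}, subset_rfl, PS.cons hxp (PS.nil _) hx ?_⟩
    intro q hq _; exact hq
  | @cons y y' z P hyy hP hy hn ih =>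
    rintro x hx ⟨p, hp, hxp⟩
    by_cases hex : ∃ p ∈ P, G.Adj x p
    · obtain ⟨P', h1, h2⟩ := ih x (fun h => hx (Or.inr h)) hex
      exact ⟨P', h1.trans (insert_subset_insert (subset_insert _ _)), h2⟩
    · have hpy : p = y := by
        rcases hp with rfl | hp
        · rfl
        · exact absurd ⟨p, hp, hxp⟩ hex
      subst hpy
      refine ⟨_, subset_rfl, PS.cons hxp (PS.cons hyy hP hy hn) hx ?_⟩
      intro q hq hxq
      rcases hq with rfl | hq
      · rfl
      · exact absurd ⟨q, hq, hxq⟩ hex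

theorem PS.snoc {G : SimpleGraph V} {x y : V} {P : Set V} (h : PS G x y P) :
    ∀ z, z ∉ P → G.Adj y z → (∀ p ∈ P, G.Adj p z → p = y) → PS G x z (insert z P) := by
  induction h with
  | nil y =>
    intro z hz hyz _
    rw [Set.pair_comm]
    refine PS.cons hyz (PS.nil z) ?_ ?_
    · intro h; rw [mem_singleton_iff] at h; subst h; exact hz rfl
    · intro p hp _; exact hp
  | @cons x y' y P hxy hP hx hn ih =>
    intro z hz hyz hzn
    rw [Set.insert_comm]
    have hyP := hP.end_mem
    refine PS.cons hxy (ih z (fun h => hz (Or.inr h)) hyz (fun p hp => hzn p (Or.inr hp))) ?_ ?_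
    · rintro (h | h)
      · exact hz (Or.inl h.symm)
      · exact hx h
    · rintro p (rfl | hp) hxp
      · have := hzn x (Or.inl rfl) hxp
        subst this; exact absurd hyP hx
      · exact hn p hp hxp

theorem PS.reverse {G : SimpleGraph V} {x y : V} {P : Set V} (h : PS G x y P) : PS G y x P := by
  induction h with
  | nil x => exact PS.nil x
  | @cons x y z P hxy hP hx hn ih =>
    exact ih.snoc x hx hxy.symm (fun p hp h => hn p hp h.symm)

theorem PS.join {G : SimpleGraph V} {x y z : V} {P Q : Set V} (h : PS G x y P) :
    PS G y z Q → (∀ p ∈ P, p ∈ Q → p = y) →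
    (∀ p ∈ P, ∀ q ∈ Q, p ≠ y → q ≠ y → ¬ G.Adj p q) → PS G x z (P ∪ Q) := by
  induction h with
  | nil y =>
    intro hQ _ _
    rwa [union_eq_self_of_subset_left (singleton_subset_iff.2 hQ.start_mem)]
  | @cons x y' y P hxy hP hx hn ih =>
    intro hQ hd ha
    rw [insert_union]
    have hyP := hP.end_mem
    have hxy' : x ≠ y := fun h => hx (h ▸ hyP)
    refine PS.cons hxy (ih hQ (fun p hp => hd p (Or.inr hp)) (fun p hp => ha p (Or.inr hp))) ?_ ?_
    · rintro (h | h)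
      · exact hx h
      · exact hxy' (hd x (Or.inl rfl) h)
    · rintro p (hp | hp) hxp
      · exact hn p hp hxp
      · by_cases hpy : p = y
        · subst hpy; exact hn p hyP hxp
        · exact absurd hxp (ha x (Or.inl rfl) p hp hxy' hpy)

theorem PS.split {G : SimpleGraph V} {x y : V} {P : Set V} (h : PS G x y P) :
    ∀ s ∈ P, ∃ P1 P2, PS G x s P1 ∧ PS G s y P2 ∧ P1 ∪ P2 = P ∧ (∀ p ∈ P1, p ∈ P2 → p = s) ∧
      (∀ p ∈ P1, ∀ q ∈ P2, p ≠ s → q ≠ s → ¬ G.Adj p q) := by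
  induction h with
  | nil x =>
    intro s hs; rw [mem_singleton_iff] at hs; subst hs
    refine ⟨{s}, {s}, PS.nil _, PS.nil _, by simp, by simp, by simp⟩
  | @cons x y z P hxy hP hx hn ih =>
    intro s hs
    rcases hs with rfl | hs
    · exact ⟨{s}, insert s P, PS.nil _, PS.cons hxy hP hx hn, by simp, by simp, by simp⟩
    · obtain ⟨P1, P2, h1, h2, h3, h4, h5⟩ := ih s hs
      have hP1 : P1 ⊆ P := h3 ▸ subset_union_left
      have hP2 : P2 ⊆ P := h3 ▸ subset_union_right
      refine ⟨insert x P1, P2, PS.cons hxy h1 (fun h => hx (hP1 h)) (fun p hp => hn p (hP1 hp)),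
        h2, by rw [insert_union, h3], ?_, ?_⟩
      · rintro p (rfl | hp) hp2
        · exact absurd (hP2 hp2) hx
        · exact h4 p hp hp2
      · rintro p (rfl | hp) q hq hps hqs hadj
        · have := hn q (hP2 hq) hadj
          subst this
          exact hqs (h4 _ h1.start_mem hq)
        · exact h5 p hp q hq hps hqs hadj

theorem PS.firsthit {G : SimpleGraph V} {x y : V} {P : Set V} (X : Set V) (h : PS G x y P) :
    (∃ p ∈ P, p ∈ X) → ∃ z ∈ X, ∃ P' ⊆ P, PS G x z P' ∧ ∀ p ∈ P', p ∈ X → p = z := by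
  induction h with
  | nil x =>
    rintro ⟨p, hp, hpX⟩
    rw [mem_singleton_iff] at hp; subst hp
    exact ⟨p, hpX, {p}, subset_rfl, PS.nil _, fun q hq _ => hq⟩
  | @cons x y z P hxy hP hx hn ih =>
    rintro ⟨p, hp, hpX⟩
    by_cases hxX : x ∈ X
    · exact ⟨x, hxX, {x}, by simp, PS.nil _, fun q hq _ => hq⟩
    · have : p ∈ P := by
        rcases hp with rfl | hp
        · exact absurd hpX hxX
        · exact hp
      obtain ⟨t, ht, P', h1, h2, h3⟩ := ih ⟨p, this, hpX⟩
      refine ⟨t, ht, insert x P', insert_subset_insert h1,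
        PS.cons hxy h2 (fun h => hx (h1 h)) (fun p hp => hn p (h1 hp)), ?_⟩
      rintro q (rfl | hq) hqX
      · exact absurd hqX hxX
      · exact h3 q hq hqX

theorem PS.twohit {G : SimpleGraph V} {x y : V} {P : Set V} (X Y : Set V) (h : PS G x y P) :
    (∀ p ∈ P, p ∈ X → p ∈ Y → False) → (∃ p ∈ P, p ∈ X) → (∃ p ∈ P, p ∈ Y) →
    (∃ z ∈ X, ∃ P' ⊆ P, PS G x z P' ∧ (∀ p ∈ P', p ∈ X → p = z) ∧ ∃ p ∈ P', p ∈ Y) ∨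
    (∃ z ∈ Y, ∃ P' ⊆ P, PS G x z P' ∧ (∀ p ∈ P', p ∈ Y → p = z) ∧ ∃ p ∈ P', p ∈ X) := by
  induction h with
  | nil x =>
    rintro hd ⟨p, hp, hpX⟩ ⟨q, hq, hqY⟩
    rw [mem_singleton_iff] at hp hq; subst hp; subst hq
    exact (hd _ rfl hpX hqY).elim
  | @cons x y z P hxy hP hx hn ih =>
    rintro hd hX hY
    have hall := PS.cons hxy hP hx hn
    by_cases hxX : x ∈ X
    · right
      obtain ⟨t, ht, P', h1, h2, h3⟩ := hall.firsthit Y hY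
      exact ⟨t, ht, P', h1, h2, h3, x, h2.start_mem, hxX⟩
    by_cases hxY : x ∈ Y
    · left
      obtain ⟨t, ht, P', h1, h2, h3⟩ := hall.firsthit X hX
      exact ⟨t, ht, P', h1, h2, h3, x, h2.start_mem, hxY⟩
    have hX' : ∃ p ∈ P, p ∈ X := by
      obtain ⟨p, rfl | hp, h⟩ := hX
      · exact absurd h hxX
      · exact ⟨p, hp, h⟩
    have hY' : ∃ p ∈ P, p ∈ Y := by
      obtain ⟨p, rfl | hp, h⟩ := hY
      · exact absurd h hxY
      · exact ⟨p, hp, h⟩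
    rcases ih (fun p hp => hd p (Or.inr hp)) hX' hY' with
      ⟨t, ht, P', h1, h2, h3, q, hq, hqY⟩ | ⟨t, ht, P', h1, h2, h3, q, hq, hqY⟩
    · left
      refine ⟨t, ht, insert x P', insert_subset_insert h1,
        PS.cons hxy h2 (fun h => hx (h1 h)) (fun p hp => hn p (h1 hp)), ?_, q, Or.inr hq, hqY⟩
      rintro q (rfl | hq) hqX
      · exact absurd hqX hxX
      · exact h3 q hq hqX
    · right
      refine ⟨t, ht, insert x P', insert_subset_insert h1,
        PS.cons hxy h2 (fun h => hx (h1 h)) (fun p hp => hn p (h1 hp)), ?_, q, Or.inr hq, hqY⟩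
      rintro q (rfl | hq) hqX
      · exact absurd hqX hxY
      · exact h3 q hq hqX

theorem PS.pred {G : SimpleGraph V} {x y : V} {P : Set V} (h : PS G x y P) (hne : x ≠ y) :
    ∃ p ∈ P, p ≠ x ∧ G.Adj x p := by
  cases h with
  | nil => exact absurd rfl hne
  | @cons _ y' _ P hxy hP hx hn =>
    exact ⟨y', Or.inr hP.start_mem, hxy.ne', hxy⟩

theorem PS.uncons {G : SimpleGraph V} {x y : V} {P : Set V} (h : PS G x y P) (hne : x ≠ y) :
    ∃ x' P', P = insert x P' ∧ x ∉ P' ∧ PS G x' y P' ∧ G.Adj x x' ∧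
      ∀ p ∈ P', G.Adj x p → p = x' := by
  cases h with
  | nil => exact absurd rfl hne
  | @cons _ y' _ P hxy hP hx hn =>
    exact ⟨y', P, rfl, hx, hP, hxy, hn⟩

theorem PS.toWalk {G : SimpleGraph V} {x y : V} {P : Set V} (h : PS G x y P) :
    ∃ p : G.Walk x y, p.IsPath ∧ (∀ z, z ∈ p.support ↔ z ∈ P) ∧
      ∀ a ∈ P, ∀ b ∈ P, G.Adj a b → s(a, b) ∈ p.edges := by
  induction h with
  | nil x => exact ⟨Walk.nil, by simp, by simp, by simp⟩
  | @cons x y z P hxy hP hx hn ih =>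
    obtain ⟨p, h1, h2, h3⟩ := ih
    refine ⟨Walk.cons hxy p, ?_, ?_, ?_⟩
    · rw [Walk.cons_isPath_iff]; exact ⟨h1, fun h => hx ((h2 x).1 h)⟩
    · intro z; simp [h2]
    · rintro a (rfl | ha) b (rfl | hb) hab
      · exact absurd hab (G.loopless.irrefl _)
      · rw [hn b hb hab]; simp
      · rw [hn a ha hab.symm]; simp [Sym2.eq_swap]
      · simp [h3 a ha b hb hab]

/-- A hole through `c`, whose remaining vertices form the induced path `R` from `r` to `t`. -/
def Hl (G : SimpleGraph V) (c r t : V) (R : Set V) : Prop :=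
  PS G r t R ∧ c ∉ R ∧ r ≠ t ∧ G.Adj c r ∧ G.Adj c t ∧ ∀ p ∈ R, G.Adj c p → p = r ∨ p = t

/-- `S` is the vertex set of a hole. -/
def HS (G : SimpleGraph V) (S : Set V) : Prop := ∃ c r t R, Hl G c r t R ∧ insert c R = S

def TF (G : SimpleGraph V) : Prop := ∀ x y z, G.Adj x y → G.Adj y z → G.Adj x z → False

def T1S (G : SimpleGraph V) : Prop :=
  ∀ S, HS G S → ∀ x, x ∉ S → ∀ y ∈ S, ∀ z ∈ S, G.Adj x y → G.Adj x z → y = z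

theorem tf_of_memF [Fintype V] {G : SimpleGraph V} (hF : MemF 2 G) : TF G := by
  classical
  intro x y z hxy hyz hxz
  have := hF.2 {x, y, z} (by
    intro p hp q hq hpq
    simp only [mem_insert_iff, mem_singleton_iff] at hp hq
    rcases hp with rfl | rfl | rfl <;> rcases hq with rfl | rfl | rfl <;>
      first | exact absurd rfl hpq | assumption | (apply SimpleGraph.Adj.symm; assumption))
  rw [Set.ncard_eq_three.2 ⟨x, y, z, hxy.ne, hxz.ne, hyz.ne, rfl⟩] at this
  omega

theorem t1_of_memF [Fintype V] {G : SimpleGraph V} (hF : MemF 2 G) : T1S G := by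
  have htf := tf_of_memF hF
  rintro S ⟨c, r, t, R, ⟨hR, hc, hrt, hcr, hct, hn⟩, rfl⟩ x hx y hy z hz hxy hxz
  obtain ⟨p, hp, hps, hpe⟩ := hR.toWalk
  have hcp : c ∉ p.support := fun h => hc ((hps c).1 h)
  have hnrt : ¬ G.Adj r t := fun h => htf c r t hcr h hct
  have hlen : 2 ≤ p.length := by
    by_contra hlt
    have : p.length = 0 ∨ p.length = 1 := by omega
    rcases this with h | h
    · exact hrt (Walk.eq_of_length_eq_zero h)
    · exact hnrt (Walk.adj_of_length_eq_one h)
  let q : G.Walk t t := Walk.cons hct.symm (Walk.cons hcr p)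
  have hmem : ∀ z, z ∈ q.support ↔ z ∈ insert c R := by
    intro z
    simp only [q, Walk.support_cons, List.mem_cons, hps, mem_insert_iff]
    have := hR.end_mem
    constructor
    · rintro (rfl | h | h)
      · exact Or.inr this
      · exact Or.inl h
      · exact Or.inr h
    · rintro (h | h)
      · exact Or.inr (Or.inl h)
      · exact Or.inr (Or.inr h)
  have hhole : IsHole G q := by
    refine ⟨?_, ?_, ?_⟩
    · rw [Walk.cons_isCycle_iff]
      refine ⟨(Walk.cons_isPath_iff _ _).2 ⟨hp, hcp⟩, ?_⟩
      rw [Walk.edges_cons, List.mem_cons]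
      rintro (h | h)
      · rw [Sym2.eq_iff] at h
        rcases h with ⟨h1, h2⟩ | ⟨h1, h2⟩
        · exact hc (h1 ▸ hR.end_mem)
        · exact hrt h1.symm
      · exact hcp (Walk.snd_mem_support_of_mem_edges _ h)
    · simp only [q, Walk.length_cons]; omega
    · intro a ha b hb hab
      rw [Walk.mem_verts_toSubgraph, hmem] at ha hb
      rw [Walk.adj_toSubgraph_iff_mem_edges]
      simp only [q, Walk.edges_cons, List.mem_cons]
      rcases ha with rfl | ha <;> rcases hb with rfl | hb
      · exact absurd rfl hab.ne
      · rcases hn b hb hab with rfl | rfl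
        · simp
        · simp [Sym2.eq_swap]
      · rcases hn a ha hab.symm with rfl | rfl
        · simp [Sym2.eq_swap]
        · simp
      · exact Or.inr (Or.inr (hpe a ha b hb hab))
  obtain ⟨a, b, hab, hall⟩ := hF.1.1 t q hhole x (fun h => hx ((hmem x).1 h))
  have hab' : G.Adj a b := hab.adj_sub
  have h1 := hall y ((hmem y).2 hy) hxy
  have h2 := hall z ((hmem z).2 hz) hxz
  rcases h1 with rfl | rfl <;> rcases h2 with rfl | rfl
  · rfl
  · exact (htf x y z hxy hab' hxz).elim
  · exact (htf x z y hxz hab' hxy).elim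
  · rfl

theorem Hl.symm {G : SimpleGraph V} {c r t : V} {R : Set V} (h : Hl G c r t R) : Hl G c t r R :=
  ⟨h.1.reverse, h.2.1, h.2.2.1.symm, h.2.2.2.2.1, h.2.2.2.1,
    fun p hp hcp => (h.2.2.2.2.2 p hp hcp).symm⟩

theorem Hl.rot {G : SimpleGraph V} {c r t : V} {R : Set V} (h : Hl G c r t R) :
    ∃ r' t' R', Hl G r r' t' R' ∧ insert r R' = insert c R := by
  obtain ⟨hR, hc, hrt, hcr, hct, hn⟩ := h
  obtain ⟨r', R', rfl, hr, hR', hrr, hn'⟩ := hR.uncons hrt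
  have hcR' : c ∉ R' := fun h => hc (Or.inr h)
  refine ⟨r', c, insert c R', ⟨?_, ?_, ?_, hrr, hcr.symm, ?_⟩, ?_⟩
  · refine hR'.snoc c hcR' hct.symm ?_
    intro p hp hpc
    rcases hn p (Or.inr hp) hpc.symm with rfl | rfl
    · exact absurd hp hr
    · rfl
  · rintro (h | h)
    · exact hcr.ne h.symm
    · exact hr h
  · rintro rfl; exact hcR' hR'.start_mem
  · rintro p (rfl | hp) hrp
    · exact Or.inr rfl
    · exact Or.inl (hn' p hp hrp)
  · exact Set.insert_comm _ _ _

theorem PS.subset_of_closed {G : SimpleGraph V} {x y : V} {P S T : Set V} (h : PS G x y P)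
    (hPS : P ⊆ S) (hT : ∀ p ∈ T, ∀ q ∈ S, G.Adj p q → q ∈ T) (hx : x ∈ T) : P ⊆ T := by
  induction h with
  | nil x => simpa using hx
  | @cons x y z P hxy hP hxP hn ih =>
    have hyT := hT x hx y (hPS (Or.inr hP.start_mem)) hxy
    exact insert_subset hx (ih (fun q hq => hPS (Or.inr hq)) hyT)

theorem HS.at {G : SimpleGraph V} {S : Set V} (h : HS G S) {s : V} (hs : s ∈ S) :
    ∃ r t R, Hl G s r t R ∧ insert s R = S := by
  obtain ⟨c, r, t, R, hH, hS⟩ := h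
  let T : Set V := {s | ∃ r t R, Hl G s r t R ∧ insert s R = S}
  have hcT : c ∈ T := ⟨r, t, R, hH, hS⟩
  have hT : ∀ p ∈ T, ∀ q ∈ S, G.Adj p q → q ∈ T := by
    rintro p ⟨r, t, R, hH, hS⟩ q hq hpq
    have hqR : q ∈ R := by
      rw [← hS] at hq
      rcases hq with rfl | hq
      · exact absurd rfl hpq.ne
      · exact hq
    rcases hH.2.2.2.2.2 q hqR hpq with rfl | rfl
    · obtain ⟨r', t', R', h1, h2⟩ := hH.rot
      exact ⟨r', t', R', h1, h2.trans hS⟩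
    · obtain ⟨r', t', R', h1, h2⟩ := hH.symm.rot
      exact ⟨r', t', R', h1, h2.trans hS⟩
  have hRT : R ⊆ T := by
    refine hH.1.subset_of_closed (S := S) (hS ▸ subset_insert _ _) hT ?_
    exact hT c hcT r (hS ▸ Or.inr hH.1.start_mem) hH.2.2.2.1
  rw [← hS] at hs
  rcases hs with rfl | hs
  · exact hcT
  · exact hRT hs

theorem HS.of_two {G : SimpleGraph V} {x y : V} {P Q : Set V} (hP : PS G x y P)
    (hQ : PS G x y Q) (hxy : x ≠ y) (hna : ¬ G.Adj x y)
    (hd : ∀ p ∈ P, p ∈ Q → p = x ∨ p = y)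
    (ha : ∀ p ∈ P, ∀ q ∈ Q, p ≠ x → p ≠ y → q ≠ x → q ≠ y → ¬ G.Adj p q) :
    HS G (P ∪ Q) := by
  obtain ⟨p', P', rfl, hxP, hP', hxp, hPn⟩ := hP.uncons hxy
  obtain ⟨q', Q', rfl, hxQ, hQ', hxq, hQn⟩ := hQ.uncons hxy
  have hd' : ∀ p ∈ P', p ∈ Q' → p = y := by
    intro p hp hq
    rcases hd p (Or.inr hp) (Or.inr hq) with rfl | h
    · exact absurd hp hxP
    · exact h
  refine ⟨x, p', q', P' ∪ Q', ⟨?_, ?_, ?_, hxp, hxq, ?_⟩, ?_⟩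
  · refine hP'.join hQ'.reverse hd' ?_
    intro p hp q hq hpy hqy
    exact ha p (Or.inr hp) q (Or.inr hq) (fun h => hxP (h ▸ hp)) hpy (fun h => hxQ (h ▸ hq)) hqy
  · rintro (h | h)
    · exact hxP h
    · exact hxQ h
  · intro h
    have := hd' p' hP'.start_mem (h ▸ hQ'.start_mem)
    subst this
    exact hna hxp
  · rintro p (hp | hp) hxp
    · exact Or.inl (hPn p hp hxp)
    · exact Or.inr (hQn p hp hxp)
  · rw [insert_union_distrib]

/-- A hole cut at two nonadjacent vertices `c`, `x`. -/
theorem Hl.arcs {G : SimpleGraph V} {c r t x : V} {R : Set V} (h : Hl G c r t R)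
    (hx : x ∈ R) (hna : ¬ G.Adj c x) :
    ∃ P Q, PS G c x P ∧ PS G c x Q ∧ P ∪ Q = insert c R ∧ (∀ p ∈ P, p ∈ Q → p = c ∨ p = x) ∧
      r ∈ P ∧ t ∈ Q := by
  obtain ⟨hR, hc, hrt, hcr, hct, hn⟩ := h
  obtain ⟨R1, R2, h1, h2, h3, h4, h5⟩ := hR.split x hx
  have s1 : R1 ⊆ R := h3 ▸ subset_union_left
  have s2 : R2 ⊆ R := h3 ▸ subset_union_right
  have hrx : r ≠ x := by rintro rfl; exact hna hcr
  have htx : t ≠ x := by rintro rfl; exact hna hct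
  refine ⟨insert c R1, insert c R2, PS.cons hcr h1 (fun h => hc (s1 h)) ?_,
    PS.cons hct h2.reverse (fun h => hc (s2 h)) ?_, ?_, ?_, Or.inr h1.start_mem, Or.inr h2.end_mem⟩
  · intro p hp hcp
    rcases hn p (s1 hp) hcp with h | rfl
    · exact h
    · exact absurd (h4 p hp h2.end_mem) htx
  · intro p hp hcp
    rcases hn p (s2 hp) hcp with rfl | h
    · exact absurd (h4 p h1.start_mem hp) hrx
    · exact h
  · rw [← insert_union_distrib, h3]
  · rintro p (rfl | hp) (hq | hq)
    · exact Or.inl rfl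
    · exact Or.inl rfl
    · exact Or.inl hq
    · exact Or.inr (h4 p hp hq)

def RC (G : SimpleGraph V) (D : Set V) (x y : V) : Prop := ∃ P ⊆ D, PS G x y P

theorem RC.refl {G : SimpleGraph V} {D : Set V} {x : V} (h : x ∈ D) : RC G D x x :=
  ⟨{x}, by simpa using h, PS.nil x⟩

theorem RC.symm {G : SimpleGraph V} {D : Set V} {x y : V} (h : RC G D x y) : RC G D y x := by
  obtain ⟨P, h1, h2⟩ := h
  exact ⟨P, h1, h2.reverse⟩

theorem RC.mem {G : SimpleGraph V} {D : Set V} {x y : V} (h : RC G D x y) : y ∈ D := by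
  obtain ⟨P, h1, h2⟩ := h
  exact h1 h2.end_mem

theorem RC.step' {G : SimpleGraph V} {D : Set V} {x y z : V} (h : RC G D x y) (hz : z ∈ D)
    (hzx : G.Adj z x) : RC G D z y := by
  obtain ⟨P, h1, h2⟩ := h
  by_cases hzP : z ∈ P
  · obtain ⟨P', h3, h4⟩ := h2.sub z hzP
    exact ⟨P', h3.trans h1, h4⟩
  · obtain ⟨P', h3, h4⟩ := h2.prepend z hzP ⟨x, h2.start_mem, hzx⟩
    exact ⟨P', h3.trans (insert_subset hz h1), h4⟩

theorem RC.step {G : SimpleGraph V} {D : Set V} {x y z : V} (h : RC G D x y) (hz : z ∈ D)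
    (hyz : G.Adj y z) : RC G D x z := (h.symm.step' hz hyz.symm).symm

theorem RC.trans {G : SimpleGraph V} {D : Set V} {x y z : V} (h : RC G D x y)
    (h' : RC G D y z) : RC G D x z := by
  obtain ⟨P, h1, h2⟩ := h
  induction h2 with
  | nil => exact h'
  | @cons x y z P hxy hP hxP hn ih =>
    exact (ih h' (fun q hq => h1 (Or.inr hq))).step' (h1 (Or.inl rfl)) hxy

theorem RC.mono {G : SimpleGraph V} {D D' : Set V} {x y : V} (h : RC G D x y) (hD : D ⊆ D') :
    RC G D' x y := by
  obtain ⟨P, h1, h2⟩ := h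
  exact ⟨P, h1.trans hD, h2⟩

/-- reachability inside the component itself -/
theorem RC.restrict {G : SimpleGraph V} {D : Set V} {x y : V} (h : RC G D x y) :
    RC G {z | RC G D x z} x y := by
  obtain ⟨P, h1, h2⟩ := h
  refine ⟨P, ?_, h2⟩
  exact h2.subset_of_closed (S := D) h1 (fun p hp q hq hpq => RC.step hp hq hpq)
    (RC.refl (h1 h2.start_mem))

/-- no clique cutset in `G[U]` -/
def NC (G : SimpleGraph V) (U : Set V) : Prop :=
  ∀ K D : Set V, G.IsClique K → K ⊆ U → D ⊆ U → D.Nonempty →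
    (∀ d ∈ D, d ∉ K) → (∀ d ∈ D, ∀ y ∈ U, G.Adj d y → y ∈ D ∨ y ∈ K) → ∀ y ∈ U, y ∈ D ∨ y ∈ K

theorem nc_conn {G : SimpleGraph V} {U : Set V} (hU : NC G U) {x y : V} (hx : x ∈ U)
    (hy : y ∈ U) : RC G U x y := by
  have := hU ∅ {z | RC G U x z} (by simp) (by simp) (fun z hz => RC.mem hz) ⟨x, RC.refl hx⟩
    (by simp) (fun d hd z hz hdz => Or.inl (RC.step hd hz hdz)) y hy
  simpa using this

theorem nc_conn1 {G : SimpleGraph V} {U : Set V} (hU : NC G U) {c x y : V} (hc : c ∈ U)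
    (hx : x ∈ U) (hy : y ∈ U) (hxc : x ≠ c) (hyc : y ≠ c) : RC G (U \ {c}) x y := by
  have := hU {c} {z | RC G (U \ {c}) x z} (by simp) (by simpa using hc) (fun z hz => (RC.mem hz).1)
    ⟨x, RC.refl ⟨hx, hxc⟩⟩ (fun z hz => (RC.mem hz).2)
    (fun d hd z hz hdz => by
      by_cases h : z = c
      · exact Or.inr h
      · exact Or.inl (RC.step hd ⟨hz, h⟩ hdz)) y hy
  rcases this with h | h
  · exact h
  · exact absurd h hyc

theorem base_hole {G : SimpleGraph V} {U : Set V} (hU : NC G U) {a u : V} (ha : a ∈ U)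
    (hu : u ∈ U) (hau : a ≠ u) (hna : ¬ G.Adj a u) : ∃ S ⊆ U, HS G S ∧ a ∈ S := by
  obtain ⟨P, hPU, hP⟩ := nc_conn hU ha hu
  obtain ⟨s, P', rfl, haP, hP', has, hn⟩ := hP.uncons hau
  have hsU : s ∈ U := hPU (Or.inr hP'.start_mem)
  have hex : ∃ t ∈ U, t ≠ s ∧ G.Adj a t := by
    by_contra hcon
    push Not at hcon
    have := hU {s} {a} (by simp) (by simpa using hsU) (by simpa using ha) (by simp)
      (by simpa using has.ne) (by
        intro d hd y hy hdy
        rw [mem_singleton_iff] at hd; subst hd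
        by_contra h
        push Not at h
        exact hcon y hy h.2 hdy) u hu
    rcases this with h | h
    · exact hau h.symm
    · rw [mem_singleton_iff] at h; subst h; exact hna has
  obtain ⟨t, htU, hts, hat⟩ := hex
  obtain ⟨Q, hQU, hQ⟩ := nc_conn1 hU ha hsU htU has.ne' hat.ne'
  obtain ⟨z, ⟨hz1, hz2⟩, Q', hQ', hQz, hfirst⟩ :=
    hQ.firsthit {z | G.Adj a z ∧ z ≠ s} ⟨t, hQ.end_mem, hat, hts⟩
  refine ⟨insert a Q', insert_subset ha (fun q hq => (hQU (hQ' hq)).1), ⟨a, s, z, Q', ⟨hQz, ?_,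
    hz2.symm, has, hz1, ?_⟩, rfl⟩, Or.inl rfl⟩
  · intro h; exact (hQU (hQ' h)).2 rfl
  · intro p hp hap
    by_cases hps : p = s
    · exact Or.inl hps
    · exact Or.inr (hfirst p hp ⟨hap, hps⟩)

/-- Every neighbour of `c` in `U` attaches to every component of `U \ N[c]`. -/
theorem nbr_attach {G : SimpleGraph V} (htf : TF G) (ht1 : T1S G) {U : Set V} (hU : NC G U)
    {c e s : V} (hc : c ∈ U) (he : e ∈ U) (hs : s ∈ U) (hec : e ≠ c) (hce : ¬ G.Adj c e)
    (hcs : G.Adj c s) : ∃ f, G.Adj s f ∧ RC G {z | z ∈ U ∧ z ≠ c ∧ ¬ G.Adj c z} f e := by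
  set W : Set V := {z | z ∈ U ∧ z ≠ c ∧ ¬ G.Adj c z} with hW
  by_contra hcon
  push Not at hcon
  let E : Set V := {z | RC G W e z}
  have heE : e ∈ E := RC.refl ⟨he, hec, hce⟩
  have hEW : ∀ z ∈ E, z ∈ W := fun z hz => RC.mem hz
  let NE : Set V := {y | y ∈ U ∧ G.Adj c y ∧ ∃ z ∈ E, G.Adj y z}
  have hsNE : s ∉ NE := by
    rintro ⟨_, _, z, hz, hsz⟩
    exact hcon z hsz (RC.symm hz)
  have hEN : ∀ z ∈ E, ∀ y ∈ U, G.Adj z y → y ∈ E ∨ y ∈ NE := by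
    intro z hz y hy hzy
    by_cases hcy : G.Adj c y
    · exact Or.inr ⟨hy, hcy, z, hz, hzy.symm⟩
    · left
      refine RC.step hz ⟨hy, ?_, hcy⟩ hzy
      rintro rfl
      exact (hEW z hz).2.2 hzy.symm
  let W2 : Set V := {z | z ∈ U ∧ z ≠ c ∧ z ∉ NE}
  let F : Set V := {z | RC G W2 s z}
  have hsF : s ∈ F := RC.refl ⟨hs, hcs.ne', hsNE⟩
  have hFW : ∀ z ∈ F, z ∈ W2 := fun z hz => RC.mem hz
  have hFE : ∀ z ∈ F, z ∉ E := by
    rintro z ⟨P, hP, hPz⟩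
    have : P ⊆ W2 ∩ Eᶜ := by
      refine hPz.subset_of_closed (S := W2) hP ?_ ?_
      · rintro p ⟨hpW, hp⟩ q hq hpq
        refine ⟨hq, fun hqE => ?_⟩
        rcases hEN q hqE p hpW.1 hpq.symm with h | h
        · exact hp h
        · exact hpW.2.2 h
      · exact ⟨RC.mem hsF, fun h => (hEW s h).2.2 hcs⟩
    exact (this hPz.end_mem).2
  have hFN : ∀ z ∈ F, ∀ y ∈ U, G.Adj z y → y ∈ F ∨ y = c ∨ y ∈ NE := by
    intro z hz y hy hzy
    by_cases h1 : y = c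
    · exact Or.inr (Or.inl h1)
    by_cases h2 : y ∈ NE
    · exact Or.inr (Or.inr h2)
    exact Or.inl (RC.step hz ⟨hy, h1, h2⟩ hzy)
  have hFEa : ∀ f ∈ F, ∀ z ∈ E, ¬ G.Adj f z := by
    intro f hf z hz hfz
    rcases hEN z hz f (hFW f hf).1 hfz.symm with h | h
    · exact hFE f hf h
    · exact (hFW f hf).2.2 h
  let Y : Set V := {y | y ∈ NE ∧ ∃ f ∈ F, G.Adj y f}
  by_cases hY : ∃ y1 ∈ Y, ∃ y2 ∈ Y, y1 ≠ y2
  · obtain ⟨y1, ⟨⟨hy1U, hcy1, e1, he1, hye1⟩, f1, hf1, hyf1⟩, y2,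
      ⟨⟨hy2U, hcy2, e2, he2, hye2⟩, f2, hf2, hyf2⟩, hne⟩ := hY
    have hnadj : ¬ G.Adj y1 y2 := fun h => htf c y1 y2 hcy1 h hcy2
    have mk : ∀ (W' : Set V) (x d1 d2 : V), RC G W' x d1 → RC G W' x d2 → G.Adj y1 d1 →
        G.Adj y2 d2 → ∃ P, PS G y1 y2 P ∧ ∀ p ∈ P, p = y1 ∨ p = y2 ∨ RC G W' x p := by
      intro W' x d1 d2 h1 h2 ha1 ha2
      let D : Set V := {p | p = y1 ∨ p = y2 ∨ RC G W' x p}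
      have hsub : {z | RC G W' x z} ⊆ D := fun z hz => Or.inr (Or.inr hz)
      have r1 : RC G D x d1 := h1.restrict.mono hsub
      have r2 : RC G D x d2 := h2.restrict.mono hsub
      obtain ⟨P, hP1, hP2⟩ := (((r1.symm.trans r2).step (Or.inr (Or.inl rfl)) ha2.symm).step'
        (Or.inl rfl) ha1 : RC G D y1 y2)
      exact ⟨P, hP2, fun p hp => hP1 hp⟩
    obtain ⟨P, hP, hPm⟩ := mk W2 s f1 f2 hf1 hf2 hyf1 hyf2
    obtain ⟨Q, hQ, hQm⟩ := mk W e e1 e2 he1 he2 hye1 hye2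
    have hcP : c ∉ P := by
      intro h
      rcases hPm c h with h | h | h
      · exact hcy1.ne h
      · exact hcy2.ne h
      · exact (RC.mem h).2.1 rfl
    have hcQ : c ∉ Q := by
      intro h
      rcases hQm c h with h | h | h
      · exact hcy1.ne h
      · exact hcy2.ne h
      · exact (RC.mem h).2.1 rfl
    have hhole : HS G (P ∪ Q) := by
      refine HS.of_two hP hQ hne hnadj ?_ ?_
      · intro p hp hq
        rcases hPm p hp with h | h | h
        · exact Or.inl h
        · exact Or.inr h
        · rcases hQm p hq with h' | h' | h'
          · exact Or.inl h'
          · exact Or.inr h'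
          · exact absurd h' (hFE p h)
      · intro p hp q hq h1 h2 h3 h4
        rcases hPm p hp with h | h | h
        · exact absurd h h1
        · exact absurd h h2
        · rcases hQm q hq with h' | h' | h'
          · exact absurd h' h3
          · exact absurd h' h4
          · exact hFEa p h q h'
    exact hne (ht1 _ hhole c (fun h => h.elim hcP hcQ) y1 (Or.inl hP.start_mem) y2
      (Or.inl hP.end_mem) hcy1 hcy2)
  · push Not at hY
    have := hU (insert c Y) F (by
        intro p hp q hq hpq
        rcases hp with rfl | hp <;> rcases hq with rfl | hq
        · exact absurd rfl hpq
        · exact hq.1.2.1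
        · exact hp.1.2.1.symm
        · exact absurd (hY p hp q hq) hpq)
      (insert_subset hc (fun y hy => hy.1.1)) (fun z hz => (hFW z hz).1) ⟨s, hsF⟩ (by
        rintro d hd (rfl | h)
        · exact (hFW _ hd).2.1 rfl
        · exact (hFW d hd).2.2 h.1) (by
        intro d hd y hy hdy
        rcases hFN d hd y hy hdy with h | h | h
        · exact Or.inl h
        · exact Or.inr (Or.inl h)
        · exact Or.inr (Or.inr ⟨h, d, hd, hdy.symm⟩)) e he
    rcases this with h | h | h
    · exact hFE e h heE
    · exact hec h
    · exact hce h.1.2.1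

theorem Hl.interior {G : SimpleGraph V} (htf : TF G) {c r t : V} {R : Set V}
    (h : Hl G c r t R) : ∃ e ∈ R, e ≠ c ∧ ¬ G.Adj c e := by
  obtain ⟨hR, hc, hrt, hcr, hct, hn⟩ := h
  obtain ⟨r', R', rfl, hr, hR', hrr, hn'⟩ := hR.uncons hrt
  refine ⟨r', Or.inr hR'.start_mem, ?_, fun h => htf c r r' hcr hrr h⟩
  rintro rfl
  exact hc (Or.inr hR'.start_mem)

theorem claim {G : SimpleGraph V} (htf : TF G) (ht1 : T1S G) {U : Set V} (hU : NC G U)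
    {C : Set V} (hC : HS G C) (hCU : C ⊆ U) {a c s : V} (ha : a ∈ C) (hc : c ∈ C)
    (hs : s ∈ U) (hsC : s ∉ C) (hcs : G.Adj c s) : ∃ S ⊆ U, HS G S ∧ a ∈ S ∧ s ∈ S := by
  obtain ⟨r, t, R, hH, hCR⟩ := hC.at hc
  obtain ⟨e, heR, hec, hce⟩ := hH.interior htf
  have heC : e ∈ C := hCR ▸ Or.inr heR
  obtain ⟨f, hsf, P, hPW, hP⟩ := nbr_attach htf ht1 hU (hCU hc) (hCU heC) hs hec hce hcs
  set W : Set V := {z | z ∈ U ∧ z ≠ c ∧ ¬ G.Adj c z} with hW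
  have hsP : s ∉ P := fun h => (hPW h).2.2 hcs
  obtain ⟨T, hTP, hT⟩ := hP.prepend s hsP ⟨f, hP.start_mem, hsf⟩
  obtain ⟨q, hqX, Q, hQT, hQ, hfirst⟩ :=
    hT.firsthit {y | y ∈ C ∨ ∃ z ∈ C, z ≠ c ∧ ¬ G.Adj c z ∧ G.Adj y z} ⟨e, hT.end_mem, Or.inl heC⟩
  have hQW : ∀ p ∈ Q, p = s ∨ p ∈ W := by
    intro p hp
    rcases hTP (hQT hp) with h | h
    · exact Or.inl h
    · exact Or.inr (hPW h)
  have hqC : q ∉ C := by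
    intro hqC
    have hqs : q ≠ s := by rintro rfl; exact hsC hqC
    obtain ⟨p, hpQ, hpq, hadj⟩ := hQ.reverse.pred hqs
    have hqW : q ∈ W := (hQW q hQ.end_mem).resolve_left hqs
    exact hpq (hfirst p hpQ (Or.inr ⟨q, hqC, hqW.2.1, hqW.2.2, hadj.symm⟩))
  obtain ⟨z, hzC, hzc, hcz, hqz⟩ := hqX.resolve_left hqC
  have hQC : ∀ p ∈ Q, p ∉ C := by
    intro p hp hpC
    have := hfirst p hp (Or.inl hpC)
    exact hqC (this ▸ hpC)
  have hcQ : c ∉ Q := fun h => hQC c h hc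
  have hzQ : z ∉ Q := fun h => hQC z h hzC
  have hzR : z ∈ R := by
    rw [← hCR] at hzC
    exact hzC.resolve_left hzc
  have hrR := hH.1.start_mem
  have htR := hH.1.end_mem
  have hrC : r ∈ C := hCR ▸ Or.inr hrR
  have htC : t ∈ C := hCR ▸ Or.inr htR
  obtain ⟨_, hcR, hrt, hcr, hct, hcn⟩ := id hH
  -- neighbours of Q in C
  have hcQn : ∀ p ∈ Q, G.Adj c p → p = s := by
    intro p hp hcp
    exact (hQW p hp).resolve_right (fun h => h.2.2 hcp)
  have hnb : ∀ p ∈ Q, ∀ y ∈ C, G.Adj p y → y = c ∨ y = r ∨ y = t ∨ y = z := by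
    intro p hp y hy hpy
    by_cases hyc : y = c
    · exact Or.inl hyc
    by_cases hcy : G.Adj c y
    · have : y ∈ R := by
        rw [← hCR] at hy
        exact hy.resolve_left hyc
      rcases hcn y this hcy with h | h
      · exact Or.inr (Or.inl h)
      · exact Or.inr (Or.inr (Or.inl h))
    · have hpq := hfirst p hp (Or.inr ⟨y, hy, hyc, hcy, hpy⟩)
      subst hpq
      exact Or.inr (Or.inr (Or.inr (ht1 C hC p hqC y hy z hzC hpy hqz)))
  have hQz : ∀ p ∈ Q, G.Adj p z → p = q := fun p hp hpz =>
    hfirst p hp (Or.inr ⟨z, hzC, hzc, hcz, hpz⟩)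
  -- the path from c to z through Q
  have hP0 : PS G c z (insert c (insert z Q)) := by
    refine PS.cons hcs (hQ.snoc z hzQ hqz hQz) ?_ ?_
    · rintro (h | h)
      · exact hzc h.symm
      · exact hcQ h
    · rintro p (rfl | hp) hcp
      · exact absurd hcp hcz
      · exact hcQn p hp hcp
  have hQU : Q ⊆ U := by
    intro p hp
    rcases hQW p hp with rfl | h
    · exact hs
    · exact h.1
  have hP0U : insert c (insert z Q) ⊆ U :=
    insert_subset (hCU hc) (insert_subset (hCU hzC) hQU)
  -- holes through one arc
  have hole : ∀ A, PS G c z A → A ⊆ C → (∀ p ∈ Q, ∀ y ∈ A, y ≠ c → y ≠ z → ¬ G.Adj p y) →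
      HS G (insert c (insert z Q) ∪ A) := by
    intro A hA hAC hanti
    refine HS.of_two hP0 hA hzc.symm hcz ?_ ?_
    · rintro p (rfl | rfl | hp) hpA
      · exact Or.inl rfl
      · exact Or.inr rfl
      · exact absurd (hAC hpA) (hQC p hp)
    · rintro p (rfl | rfl | hp) y hy h1 h2 h3 h4
      · exact absurd rfl h1
      · exact absurd rfl h2
      · exact hanti p hp y hy h3 h4
  have hrc : r ≠ c := hcr.ne'
  have htc : t ≠ c := hct.ne'
  have hrz : r ≠ z := by rintro rfl; exact hcz hcr
  have htz : t ≠ z := by rintro rfl; exact hcz hct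
  obtain ⟨A1, A2, hA1, hA2, hA, hAd, hrA, htA⟩ := hH.arcs hzR hcz
  rw [hCR] at hA
  have hA1C : A1 ⊆ C := hA ▸ subset_union_left
  have hA2C : A2 ⊆ C := hA ▸ subset_union_right
  have hrA2 : r ∉ A2 := fun h => (hAd r hrA h).elim hrc hrz
  have htA1 : t ∉ A1 := fun h => (hAd t h htA).elim htc htz
  have hsQ : s ∈ Q := hQ.start_mem
  -- generic contradiction for a short hole
  have short : ∀ r t, r ∈ C → t ∈ C → r ≠ t → G.Adj c r → G.Adj c t → r ≠ c → t ≠ c →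
      ¬ (∃ p' ∈ {y | G.Adj y t}, ∃ P' ⊆ Q, PS G s p' P' ∧ (∀ p ∈ P', p ∈ {y | G.Adj y t} → p = p') ∧
        ∃ p ∈ P', p ∈ {y | G.Adj y r}) := by
    rintro r t hrC htC hrt hcr hct hrc htc ⟨p', hp't, P', hP'Q, hP', hP't, p, hpP', hpr⟩
    have htP' : t ∉ P' := fun h => hQC t (hP'Q h) htC
    have hHl : Hl G c s t (insert t P') := by
      refine ⟨hP'.snoc t htP' hp't hP't, ?_, ?_, hcs, hct, ?_⟩
      · rintro (h | h)
        · exact htc h.symm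
        · exact hcQ (hP'Q h)
      · rintro rfl; exact hsC htC
      · rintro p (rfl | hp) hcp
        · exact Or.inr rfl
        · exact Or.inl (hcQn p (hP'Q hp) hcp)
    have := ht1 _ ⟨c, s, t, _, hHl, rfl⟩ r (by
      rintro (h | h | h)
      · exact hrc h
      · exact hrt h
      · exact hQC r (hP'Q h) hrC) c (Or.inl rfl) p (Or.inr (Or.inr hpP')) hcr.symm hpr.symm
    exact hcQ (this ▸ hP'Q hpP')
  have hnoboth : ¬ ((∃ p ∈ Q, G.Adj p r) ∧ (∃ p ∈ Q, G.Adj p t)) := by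
    rintro ⟨hr, ht⟩
    rcases hQ.twohit {y | G.Adj y r} {y | G.Adj y t} (fun p hp h1 h2 =>
      hrt (ht1 C hC p (hQC p hp) r hrC t htC h1 h2)) hr ht with h | h
    · exact short t r htC hrC hrt.symm hct hcr htc hrc h
    · exact short r t hrC htC hrt hcr hct hrc htc h
  have anti1 : (∀ p ∈ Q, ¬ G.Adj p r) →
      ∀ p ∈ Q, ∀ y ∈ A1, y ≠ c → y ≠ z → ¬ G.Adj p y := by
    intro h p hp y hy hyc hyz hpy
    rcases hnb p hp y (hA1C hy) hpy with rfl | rfl | rfl | rfl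
    · exact hyc rfl
    · exact h p hp hpy
    · exact htA1 hy
    · exact hyz rfl
  have anti2 : (∀ p ∈ Q, ¬ G.Adj p t) →
      ∀ p ∈ Q, ∀ y ∈ A2, y ≠ c → y ≠ z → ¬ G.Adj p y := by
    intro h p hp y hy hyc hyz hpy
    rcases hnb p hp y (hA2C hy) hpy with rfl | rfl | rfl | rfl
    · exact hyc rfl
    · exact hrA2 hy
    · exact h p hp hpy
    · exact hyz rfl
  have hnr : ∀ p ∈ Q, ¬ G.Adj p r := by
    intro p hp hpr
    have ht : ∀ p ∈ Q, ¬ G.Adj p t := fun p' hp' h => hnoboth ⟨⟨p, hp, hpr⟩, p', hp', h⟩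
    have := ht1 _ (hole A2 hA2 hA2C (anti2 ht)) r (by
      rintro ((h | h | h) | h)
      · exact hrc h
      · exact hrz h
      · exact hQC r h hrC
      · exact hrA2 h) c (Or.inl (Or.inl rfl)) p (Or.inl (Or.inr (Or.inr hp))) hcr.symm hpr.symm
    exact hcQ (this ▸ hp)
  have hnt : ∀ p ∈ Q, ¬ G.Adj p t := by
    intro p hp hpt
    have := ht1 _ (hole A1 hA1 hA1C (anti1 hnr)) t (by
      rintro ((h | h | h) | h)
      · exact htc h
      · exact htz h
      · exact hQC t h htC
      · exact htA1 h) c (Or.inl (Or.inl rfl)) p (Or.inl (Or.inr (Or.inr hp))) hct.symm hpt.symm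
    exact hcQ (this ▸ hp)
  rw [← hA] at ha
  rcases ha with ha | ha
  · exact ⟨_, union_subset hP0U (hA1C.trans hCU), hole A1 hA1 hA1C (anti1 hnr), Or.inr ha,
      Or.inl (Or.inr (Or.inr hsQ))⟩
  · exact ⟨_, union_subset hP0U (hA2C.trans hCU), hole A2 hA2 hA2C (anti2 hnt), Or.inr ha,
      Or.inl (Or.inr (Or.inr hsQ))⟩

theorem common_hole {G : SimpleGraph V} (htf : TF G) (ht1 : T1S G) {U : Set V} (hU : NC G U)
    {a u : V} (ha : a ∈ U) (hu : u ∈ U) (hau : a ≠ u) (hna : ¬ G.Adj a u) :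
    ∃ S ⊆ U, HS G S ∧ a ∈ S ∧ u ∈ S := by
  obtain ⟨S0, hS0, hH0, ha0⟩ := base_hole hU ha hu hau hna
  obtain ⟨P, hPU, hP⟩ := nc_conn hU hu ha
  clear hu hau hna
  induction hP with
  | nil a => exact ⟨S0, hS0, hH0, ha0, ha0⟩
  | @cons x y z P hxy hP hxP hn ih =>
    obtain ⟨S, h1, h2, h3, h4⟩ := ih ha ha0 (fun p hp => hPU (Or.inr hp))
    by_cases hxS : x ∈ S
    · exact ⟨S, h1, h2, h3, hxS⟩
    · exact claim htf ht1 hU h2 h1 h3 h4 (hPU (Or.inl rfl)) hxS hxy.symm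

/-- a clique of `G[U]` separates `a` from `u` in `G[U]` -/
def SepU (G : SimpleGraph V) (a u : V) (U : Set V) : Prop :=
  ∃ K A B : Set V, G.IsClique K ∧ (∀ x, x ∈ U ↔ x ∈ A ∨ x ∈ K ∨ x ∈ B) ∧ a ∈ A ∧ u ∈ B ∧
    (∀ x ∈ A, x ∉ K) ∧ (∀ x ∈ A, x ∉ B) ∧ (∀ x ∈ B, x ∉ K) ∧ ∀ x ∈ A, ∀ y ∈ B, ¬ G.Adj x y

theorem sepU_ext {G : SimpleGraph V} {a u : V} {U K D1 D2 : Set V} (hK : G.IsClique K)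
    (hU : ∀ x, x ∈ U ↔ x ∈ D1 ∨ x ∈ K ∨ x ∈ D2) (h1K : ∀ x ∈ D1, x ∉ K) (h2K : ∀ x ∈ D2, x ∉ K)
    (h12 : ∀ x ∈ D1, x ∉ D2) (han : ∀ x ∈ D1, ∀ y ∈ D2, ¬ G.Adj x y)
    (h : SepU G a u (D1 ∪ K)) : SepU G a u U := by
  obtain ⟨K', A, B, hK', hpart, haA, huB, hAK, hAB, hBK, hanti⟩ := h
  have hdisj : ∀ x ∈ D2, x ∉ D1 ∪ K := by
    rintro x hx (h | h)
    · exact h12 x h hx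
    · exact h2K x hx h
  have hA : ∀ x ∈ A, x ∈ D1 ∪ K := fun x hx => (hpart x).2 (Or.inl hx)
  have hB : ∀ x ∈ B, x ∈ D1 ∪ K := fun x hx => (hpart x).2 (Or.inr (Or.inr hx))
  have hKK : ∀ x ∈ K', x ∈ D1 ∪ K := fun x hx => (hpart x).2 (Or.inr (Or.inl hx))
  have hUx : ∀ x, x ∈ U ↔ (x ∈ A ∨ x ∈ K' ∨ x ∈ B) ∨ x ∈ D2 := by
    intro x
    rw [hU, ← hpart]
    simp only [mem_union]
    tauto
  by_cases hKA : ∃ k ∈ K, k ∈ A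
  · obtain ⟨k, hkK, hkA⟩ := hKA
    have hKB : ∀ x ∈ B, x ∈ D1 := by
      intro x hx
      refine (hB x hx).resolve_right (fun hxK => ?_)
      have hne : k ≠ x := by rintro rfl; exact hAB k hkA hx
      exact hanti k hkA x hx (hK hkK hxK hne)
    refine ⟨K', A ∪ D2, B, hK', ?_, Or.inl haA, huB, ?_, ?_, hBK, ?_⟩
    · intro x; rw [hUx]; simp only [mem_union]; tauto
    · rintro x (h | h) h'
      · exact hAK x h h'
      · exact hdisj x h (hKK x h')
    · rintro x (h | h) h'
      · exact hAB x h h'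
      · exact hdisj x h (hB x h')
    · rintro x (h | h) y hy hxy
      · exact hanti x h y hy hxy
      · exact han y (hKB y hy) x h hxy.symm
  · push Not at hKA
    have hKA' : ∀ x ∈ A, x ∈ D1 := fun x hx => (hA x hx).resolve_right (fun h => hKA x h hx)
    refine ⟨K', A, B ∪ D2, hK', ?_, haA, Or.inl huB, hAK, ?_, ?_, ?_⟩
    · intro x; rw [hUx]; simp only [mem_union]; tauto
    · rintro x h (h' | h')
      · exact hAB x h h'
      · exact hdisj x h' (hA x h)
    · rintro x (h | h) h'
      · exact hBK x h h'
      · exact hdisj x h (hKK x h')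
    · rintro x h y (hy | hy) hxy
      · exact hanti x h y hy hxy
      · exact han x (hKA' x h) y hy hxy

theorem sepU_main [Finite V] {G : SimpleGraph V} (htf : TF G) (ht1 : T1S G) {a u : V}
    (hau : a ≠ u) (hna : ¬ G.Adj a u) (U : Set V) (ha : a ∈ U) (hu : u ∈ U)
    (hno : ∀ S ⊆ U, HS G S → a ∈ S → u ∈ S → False) : SepU G a u U := by
  induction hn : U.ncard using Nat.strong_induction_on generalizing U with
  | _ n ih =>
    by_contra hsep
    have hNC : NC G U := by
      intro K D hK hKU hDU hDne hDK hDN y hy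
      by_contra hyn
      push Not at hyn
      let D' : Set V := {x | x ∈ U ∧ x ∉ D ∧ x ∉ K}
      have hpart : ∀ x, x ∈ U ↔ x ∈ D ∨ x ∈ K ∨ x ∈ D' := by
        intro x
        constructor
        · intro hx
          by_cases h1 : x ∈ D
          · exact Or.inl h1
          by_cases h2 : x ∈ K
          · exact Or.inr (Or.inl h2)
          exact Or.inr (Or.inr ⟨hx, h1, h2⟩)
        · rintro (h | h | h)
          · exact hDU h
          · exact hKU h
          · exact h.1
      have hpart' : ∀ x, x ∈ U ↔ x ∈ D' ∨ x ∈ K ∨ x ∈ D := by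
        intro x; rw [hpart]; tauto
      have hDD' : ∀ x ∈ D, x ∉ D' := fun x hx h => h.2.1 hx
      have hD'D : ∀ x ∈ D', x ∉ D := fun x hx => hx.2.1
      have hD'K : ∀ x ∈ D', x ∉ K := fun x hx => hx.2.2
      have han : ∀ x ∈ D, ∀ y ∈ D', ¬ G.Adj x y := by
        intro x hx y hy hxy
        rcases hDN x hx y hy.1 hxy with h | h
        · exact hy.2.1 h
        · exact hy.2.2 h
      have han' : ∀ x ∈ D', ∀ y ∈ D, ¬ G.Adj x y := fun x hx y hy h => han y hy x hx h.symm
      have rec1 : ∀ D1 : Set V, D1 ∪ K ⊂ U → a ∈ D1 ∪ K → u ∈ D1 ∪ K → SepU G a u (D1 ∪ K) := by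
        intro D1 hss ha' hu'
        refine ih _ ?_ (D1 ∪ K) ha' hu' (fun S hS => hno S (hS.trans hss.1)) rfl
        rw [← hn]
        exact Set.ncard_lt_ncard hss (Set.toFinite _)
      have hss1 : D ∪ K ⊂ U := by
        refine ⟨union_subset hDU hKU, fun h => ?_⟩
        rcases h hy with h | h
        · exact hyn.1 h
        · exact hyn.2 h
      have hss2 : D' ∪ K ⊂ U := by
        refine ⟨union_subset (fun x hx => hx.1) hKU, fun h => ?_⟩
        obtain ⟨d, hd⟩ := hDne
        rcases h (hDU hd) with h | h
        · exact hDD' d hd h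
        · exact hDK d hd h
      by_cases h1 : a ∈ D ∪ K ∧ u ∈ D ∪ K
      · exact hsep (sepU_ext hK hpart hDK hD'K hDD' han (rec1 D hss1 h1.1 h1.2))
      by_cases h2 : a ∈ D' ∪ K ∧ u ∈ D' ∪ K
      · exact hsep (sepU_ext hK hpart' hD'K hDK hD'D han' (rec1 D' hss2 h2.1 h2.2))
      have pa := (hpart a).1 ha
      have pu := (hpart u).1 hu
      simp only [mem_union] at h1 h2
      by_cases haD : a ∈ D
      · have huD' : u ∈ D' := by tauto
        exact hsep ⟨K, D, D', hK, hpart, haD, huD', hDK, hDD', hD'K, han⟩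
      · have haD' : a ∈ D' := by tauto
        have huD : u ∈ D := by tauto
        exact hsep ⟨K, D', D, hK, hpart', haD', huD, hD'K, hD'D, hDK, han'⟩
    obtain ⟨S, h1, h2, h3, h4⟩ := common_hole htf ht1 hNC ha hu hau hna
    exact hno S h1 h2 h3 h4

theorem comp_rc {G : SimpleGraph V} {X : Set V} {a : V} (ha : a ∉ X) :
    IsComponentOf G X {y | RC G Xᶜ a y} := by
  refine ⟨⟨a, RC.refl ha⟩, fun y hy => RC.mem hy, ?_, ?_⟩
  · refine induce_connected_of_patches a (RC.refl ha) ?_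
    intro v hv
    obtain ⟨P, hP, hPS⟩ := RC.restrict hv
    obtain ⟨p, -, h2, -⟩ := hPS.toWalk
    refine ⟨{z | z ∈ p.support}, fun z hz => hP ((h2 z).1 hz), p.start_mem_support,
      p.end_mem_support, ?_⟩
    exact p.connected_induce_support.preconnected _ _
  · intro D' hsub hX hconn
    refine Set.Subset.antisymm ?_ hsub
    intro y hy
    obtain ⟨p⟩ := hconn.preconnected ⟨a, hsub (RC.refl ha)⟩ ⟨y, hy⟩
    have key : ∀ (s t : D') (p : (G.induce D').Walk s t), RC G Xᶜ a s → RC G Xᶜ a t := by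
      intro s t p
      induction p with
      | nil => exact id
      | @cons s t r h p ih =>
        intro hs
        exact ih (hs.step (hX t.2) h)
    exact key _ _ p (RC.refl ha)

theorem comp_closed {G : SimpleGraph V} {X D : Set V} (hD : IsComponentOf G X D) {d y : V}
    (hd : d ∈ D) (hy : y ∉ X) (hdy : G.Adj d y) : y ∈ D := by
  obtain ⟨-, h2, h3, h4⟩ := hD
  have h := h4 (D ∪ {d, y}) Set.subset_union_left ?_
    (induce_union_connected h3.preconnected (induce_pair_connected_of_adj hdy).preconnected
      ⟨d, hd, by simp⟩)
  · rw [← h]; simp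
  · rintro z (hz | rfl | rfl)
    · exact h2 hz
    · exact h2 hd
    · exact hy

theorem comp_eq {G : SimpleGraph V} {X D E : Set V} (hD : IsComponentOf G X D)
    (hE : IsComponentOf G X E) {z : V} (h1 : z ∈ D) (h2 : z ∈ E) : D = E := by
  have hc := induce_union_connected hD.2.2.1.preconnected hE.2.2.1.preconnected ⟨z, h1, h2⟩
  have hs : D ∪ E ⊆ Xᶜ := Set.union_subset hD.2.1 hE.2.1
  rw [← hD.2.2.2 _ Set.subset_union_left hs hc]
  exact hE.2.2.2 _ Set.subset_union_right hs hc

theorem path_deg {G : SimpleGraph V} {x y : V} (P : G.Walk x y) (hP : IsIPath G P) {d : V}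
    (hd : d ∈ P.support) (hN : ∀ z, G.Adj d z → z ∈ P.support) : deg G d ≤ 2 := by
  have hsub : G.neighborSet d ⊆ P.toSubgraph.neighborSet d := by
    intro z hz
    exact hP.2 (by simpa using hd) (by simpa using hN z hz) hz
  have hle : deg G d ≤ (P.toSubgraph.neighborSet d).ncard :=
    Set.ncard_le_ncard hsub P.finite_neighborSet_toSubgraph
  refine hle.trans ?_
  obtain ⟨i, hi, hil⟩ := (Walk.mem_support_iff_exists_getVert).1 hd
  by_cases hn : P.Nil
  · cases hn
    simp
  by_cases h0 : i = 0
  · subst h0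
    rw [Walk.getVert_zero] at hi
    subst hi
    rw [hP.1.neighborSet_toSubgraph_startpoint hn]; simp
  by_cases h1 : i < P.length
  · rw [← hi, hP.1.ncard_neighborSet_toSubgraph_internal_eq_two h0 h1]
  · have : i = P.length := by omega
    subst this
    rw [Walk.getVert_length] at hi
    subst hi
    rw [hP.1.neighborSet_toSubgraph_endpoint hn]; simp

theorem exists_min_sep [Finite V] {G : SimpleGraph V} {a v u : V} {K : Set V} (ha : a ≠ v)
    (hau : a ∉ K) (hu : u ∉ K) (huv : u ≠ v)
    (hK : ¬ RC G ({v} ∪ K)ᶜ a u) :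
    ∃ K' ⊆ K, ¬ RC G ({v} ∪ K')ᶜ a u ∧
      (∀ k ∈ K', ∃ d, RC G ({v} ∪ K')ᶜ a d ∧ G.Adj k d) := by
  obtain ⟨K', hK', hmin⟩ := Set.Finite.exists_minimal (s := {L : Set V | L ⊆ K ∧ ¬ RC G ({v} ∪ L)ᶜ a u})
    (Set.toFinite _) ⟨K, Set.Subset.rfl, hK⟩
  refine ⟨K', hK'.1, hK'.2, ?_⟩
  intro k hk
  by_contra hno
  push Not at hno
  have hn : RC G ({v} ∪ (K' \ {k}))ᶜ a u := by
    by_contra hn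
    have := hmin (y := K' \ {k}) ⟨fun z hz => hK'.1 hz.1, hn⟩ Set.diff_subset hk
    exact this.2 rfl
  obtain ⟨P, hP, hPS⟩ := hn
  refine hK'.2 ?_
  have haX : a ∈ ({v} ∪ K')ᶜ := by
    rintro (h | h)
    · exact ha h
    · exact hau (hK'.1 h)
  have := hPS.subset_of_closed (T := {y | RC G ({v} ∪ K')ᶜ a y}) hP ?_ (RC.refl haX)
  · exact this hPS.end_mem
  · intro p hp q hq hpq
    refine RC.step hp ?_ hpq
    rintro (h | h)
    · exact hq (Or.inl h)
    · by_cases hqk : q = k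
      · subst hqk; exact hno p hp hpq.symm
      · exact hq (Or.inr ⟨h, hqk⟩)

theorem exists_proper [Fintype V] {G : SimpleGraph V} {w : V → ℝ}
    (hF : MemF 2 G) (hunb : Unbalanced G w 4)
    {a v u : V} (hsg : HeavySeagull G a v u) :
    ∃ K₁ K₂ B : Set V, G.IsClique K₁ ∧ G.IsClique K₂ ∧
      K₁.ncard ≤ 2 ∧ K₂.ncard ≤ 2 ∧ ProperPair G w K₁ K₂ B ∧
      ((B ∪ K₁ ∪ K₂)ᶜ ∩ {a, u}).Nonempty := by
  obtain ⟨hau, hav, hvu, hnau, hda, hdu⟩ := hsg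
  have htf := tf_of_memF hF
  have ht1 := t1_of_memF hF
  obtain ⟨K, A, B, hK, hU, haA, huB, hAK, hAB, hBK, hnad⟩ :=
    sepU_main htf ht1 hau hnau {v}ᶜ hav.ne hvu.ne' (by
      intro S hS hH haS huS
      exact hau (ht1 S hH v (fun h => hS h rfl) a haS u huS hav.symm hvu))
  have hvK : v ∉ K := fun h => ((hU v).2 (Or.inr (Or.inl h))) rfl
  have hsep : ¬ RC G ({v} ∪ K)ᶜ a u := by
    rintro ⟨P, hP, hPS⟩
    have := hPS.subset_of_closed (T := A) hP (by
      intro p hp q hq hpq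
      rcases (hU q).1 (fun h => hq (Or.inl h)) with h | h | h
      · exact h
      · exact absurd (Or.inr h) hq
      · exact absurd hpq (hnad p hp q h)) haA hPS.end_mem
    exact hAB u this huB
  have haK : a ∉ K := hAK a haA
  have huK : u ∉ K := hBK u huB
  obtain ⟨K1, hK1K, hs1, hn1⟩ := exists_min_sep hav.ne haK huK hvu.ne' hsep
  obtain ⟨K2, hK2K1, hs2, hn2⟩ := exists_min_sep hvu.ne' (fun h => huK (hK1K h))
    (fun h => haK (hK1K h)) hav.ne (fun h => hs1 h.symm)
  -- K2 is minimal from the side of u; rebuild the neighbours on the side of a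
  have hn2a : ∀ k ∈ K2, ∃ d, RC G ({v} ∪ K2)ᶜ a d ∧ G.Adj k d := by
    intro k hk
    obtain ⟨d, hd, hkd⟩ := hn1 k (hK2K1 hk)
    refine ⟨d, hd.mono ?_, hkd⟩
    intro z hz h
    exact hz (h.imp id (fun h => hK2K1 h))
  have hcl : G.IsClique K2 := hK.subset (hK2K1.trans hK1K)
  have hc2 : K2.ncard ≤ 2 := hF.2 _ hcl
  have hvK2 : v ∉ K2 := fun h => hvK (hK1K (hK2K1 h))
  have haX : a ∉ ({v} ∪ K2 : Set V) := by
    rintro (h | h)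
    · exact hav.ne h
    · exact haK (hK1K (hK2K1 h))
  have huX : u ∉ ({v} ∪ K2 : Set V) := by
    rintro (h | h)
    · exact hvu.ne' h
    · exact huK (hK1K (hK2K1 h))
  have hX4 : ({v} ∪ K2 : Set V).ncard ≤ 4 := by
    have := Set.ncard_union_le {v} K2
    rw [Set.ncard_singleton] at this
    omega
  have hnb := hunb.2 _ hX4
  unfold IsBalSep at hnb
  push Not at hnb
  obtain ⟨Bc, hBc, hwB⟩ := hnb
  have hfin : ∀ d0, d0 ∉ ({v} ∪ K2 : Set V) → d0 ∈ ({a, u} : Set V) → G.Adj v d0 →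
      (∀ k ∈ K2, ∃ d, RC G ({v} ∪ K2)ᶜ d0 d ∧ G.Adj k d) → 3 ≤ deg G d0 → d0 ∉ Bc →
      ∃ K₁ K₂ B : Set V, G.IsClique K₁ ∧ G.IsClique K₂ ∧
      K₁.ncard ≤ 2 ∧ K₂.ncard ≤ 2 ∧ ProperPair G w K₁ K₂ B ∧
      ((B ∪ K₁ ∪ K₂)ᶜ ∩ {a, u}).Nonempty := by
    intro d0 hd0 hd0' hvd hk hdeg hdB
    have hD := comp_rc (G := G) hd0
    have hd0D : d0 ∈ {y | RC G ({v} ∪ K2)ᶜ d0 y} := RC.refl hd0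
    have hDsub : {y | RC G ({v} ∪ K2)ᶜ d0 y} ⊆ (Bc ∪ {v} ∪ K2)ᶜ := by
      rintro z hz ((h | h) | h)
      · have := comp_eq hD hBc hz h
        exact hdB (this ▸ hd0D)
      · exact hD.2.1 hz (Or.inl h)
      · exact hD.2.1 hz (Or.inr h)
    refine ⟨{v}, K2, Bc, Set.pairwise_singleton _ _, hcl, by simp, hc2, ?_, d0, hDsub hd0D, hd0'⟩
    refine ⟨⟨hBc, hwB⟩, ⟨_, hD, hDsub, ?_⟩, ?_⟩
    · rintro k (h | h)
      · have h : k = v := h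
        subst h
        exact ⟨fun h' => hD.2.1 h' (Or.inl rfl), d0, hd0D, hvd⟩
      · obtain ⟨d, hd, hkd⟩ := hk k h
        exact ⟨fun h' => hD.2.1 h' (Or.inr h), d, hd, hkd⟩
    · rintro - - ⟨x, y, P, -, -, hP, hsup⟩
      have hin : ∀ z, z ∈ (Bc ∪ {v} ∪ K2)ᶜ ∪ {v} ∪ K2 → z ∈ P.support := by
        intro z hz; rw [← hsup] at hz; exact hz
      have := path_deg P hP (hin d0 (Or.inl (Or.inl (hDsub hd0D)))) (by
        intro z hz
        by_cases hzX : z ∈ ({v} ∪ K2 : Set V)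
        · rcases hzX with h | h
          · exact hin z (Or.inl (Or.inr h))
          · exact hin z (Or.inr h)
        · exact hin z (Or.inl (Or.inl (hDsub (comp_closed hD hd0D hzX hz)))))
      omega
  by_cases haB : a ∈ Bc
  · refine hfin u huX (by simp) hvu hn2 hdu ?_
    intro huB
    have := comp_eq hBc (comp_rc (G := G) haX) haB (RC.refl haX)
    rw [this] at huB
    exact hs2 huB.symm
  · exact hfin a haX (by simp) hav.symm hn2a hda haB

theorem proper_sub {G : SimpleGraph V} {w : V → ℝ} {K₁ K₂ B L₁ L₂ C : Set V}
    (h : ProperPair G w K₁ K₂ B) (h' : ProperPair G w L₁ L₂ C)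
    (heq : C ∪ L₁ ∪ L₂ = B ∪ K₁ ∪ K₂) : L₁ ∪ L₂ ⊆ K₁ ∪ K₂ := by
  intro k hk
  obtain ⟨-, ⟨D, hD, hDs, hN⟩, -⟩ := h'
  obtain ⟨-, d, hd, hkd⟩ := hN hk
  have hds := hDs hd
  rw [heq, Set.union_assoc] at hds
  have hkS : k ∈ B ∪ K₁ ∪ K₂ := by
    rw [← heq, Set.union_assoc]; exact Or.inr hk
  rw [Set.union_assoc] at hkS
  rcases hkS with hB | hK
  · exact absurd (Or.inl (comp_closed h.1.1 hB (fun h => hds (Or.inr h)) hkd)) hds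
  · exact hK

theorem exists_active [Fintype V] {G : SimpleGraph V} {w : V → ℝ}
    (hF : MemF 2 G) (hunb : Unbalanced G w 4)
    {a v u : V} (hsg : HeavySeagull G a v u) :
    ∃ K₁ K₂ B : Set V, G.IsClique K₁ ∧ G.IsClique K₂ ∧
      K₁.ncard ≤ 2 ∧ K₂.ncard ≤ 2 ∧ ActivePair G w 2 K₁ K₂ B ∧
      ((B ∪ K₁ ∪ K₂)ᶜ ∩ {a, u}).Nonempty := by
  obtain ⟨K₁, K₂, B, h⟩ := exists_proper hF hunb hsg
  obtain ⟨S, ⟨K₁, K₂, B, rfl, h1, h2, h3, h4, h5, h6⟩, hmin⟩ :=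
    Set.Finite.exists_minimal (s := {S : Set V | ∃ K₁ K₂ B : Set V, B ∪ K₁ ∪ K₂ = S ∧
      G.IsClique K₁ ∧ G.IsClique K₂ ∧
      K₁.ncard ≤ 2 ∧ K₂.ncard ≤ 2 ∧ ProperPair G w K₁ K₂ B ∧
      ((B ∪ K₁ ∪ K₂)ᶜ ∩ {a, u}).Nonempty}) (Set.toFinite _) ⟨_, K₁, K₂, B, rfl, h⟩
  refine ⟨K₁, K₂, B, h1, h2, h3, h4, ⟨h5, ?_⟩, h6⟩
  intro L₁ L₂ C c1 c2 c3 c4 c5 hne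
  refine ⟨?_, ?_⟩
  · intro hss
    refine hss.2 (hmin ⟨L₁, L₂, C, rfl, c1, c2, c3, c4, c5, ?_⟩ hss.1)
    obtain ⟨z, hz, hz'⟩ := h6
    exact ⟨z, fun h => hz (hss.1 h), hz'⟩
  · intro heq
    exact absurd (Set.Subset.antisymm (proper_sub c5 h5 heq.symm) (proper_sub h5 c5 heq)) hne

end

/-- Theorem `breakextheavyseagull`. -/
theorem statement16 {V : Type} [Fintype V] (G : SimpleGraph V) (w : V → ℝ)
    (hF : MemF 2 G) (hunb : Unbalanced G w 4) (hns : ¬HasStarCutset G)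
    (a v₁ u₁ : V) (hsg : HeavySeagull G a v₁ u₁) :
    ∃ K₁ K₂ B : Set V, G.IsClique K₁ ∧ G.IsClique K₂ ∧
      K₁.ncard ≤ 2 ∧ K₂.ncard ≤ 2 ∧ ActivePair G w 2 K₁ K₂ B ∧
      ((B ∪ K₁ ∪ K₂)ᶜ ∩ {a, u₁}).Nonempty := by
  exact exists_active hF hunb hsg

end Paper
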